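/- arXiv:2110.12256 — 3 statements merged into one kernel-verified Lean document; each statement's English description precedes it below -/
import Mathlib

section
/- Let 0 < a < b. Let V and W be independent real random variables on a probability space, with V ≥ 0 almost surely, W exponential(b) distributed, and V + W exponential(a) distributed. Then the law of V equals the mixture (a/b)·δ_0 + (1 − a/b)·exponential(a); in particular P(V = 0) = a/b and P(V > x) = (1 − a/b)·e^{−ax} for every x ≥ 0. -/
open MeasureTheory ProbabilityTheory Set

lemma charFun_expMeasure {r : ℝ} (hr : 0 < r) (t : ℝ) :
    charFun (expMeasure r) t = r / (r - t * Complex.I) := by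
  have hre : (t * Complex.I - r : ℂ).re < 0 := by simpa using hr
  have hdens : expMeasure r = volume.withDensity (exponentialPDF r) := rfl
  have hmeas : Measurable (exponentialPDF r) :=
    (measurable_exponentialPDFReal r).ennreal_ofReal
  have hpdf : ∀ x, (exponentialPDF r x).toReal •
        Complex.exp (t * x * Complex.I)
      = (Ici (0 : ℝ)).indicator
        (fun x : ℝ => (r : ℂ) * Complex.exp ((t * Complex.I - r) * x)) x := by
    intro x
    rw [exponentialPDF_eq]
    by_cases hx : 0 ≤ x
    · rw [if_pos hx, indicator_of_mem (mem_Ici.2 hx), ENNReal.toReal_ofReal (by positivity),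
        Complex.real_smul]
      push_cast
      rw [mul_assoc, ← Complex.exp_add]
      congr 2
      ring
    · rw [if_neg hx, indicator_of_notMem (by simpa using hx)]
      simp
  rw [charFun_apply_real, hdens, integral_withDensity_eq_integral_toReal_smul hmeas
    (Filter.Eventually.of_forall fun x => ENNReal.ofReal_lt_top)]
  simp_rw [hpdf]
  rw [integral_indicator measurableSet_Ici, integral_Ici_eq_integral_Ioi, integral_const_mul,
    integral_exp_mul_complex_Ioi hre]
  rw [← neg_sub (r : ℂ), Complex.ofReal_zero, mul_zero, Complex.exp_zero]
  field_simp

lemma expMeasure_singleton (r x : ℝ) : expMeasure r {x} = 0 :=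
  withDensity_absolutelyContinuous _ _ (measure_singleton x)

lemma expMeasure_Ioi {r x : ℝ} (hr : 0 < r) (hx : 0 ≤ x) :
    expMeasure r (Ioi x) = ENNReal.ofReal (Real.exp (-r * x)) := by
  have := isProbabilityMeasure_expMeasure hr
  rw [← compl_Iic, prob_compl_eq_one_sub measurableSet_Iic, ← ofReal_cdf,
    cdf_expMeasure_eq hr, if_pos hx, ← ENNReal.ofReal_one, ← ENNReal.ofReal_sub _
      (sub_nonneg.2 (Real.exp_le_one_iff.2 (by nlinarith)))]
  simp

/-- **Proposition 2 of the paper with the subsequent remark (spectrally negative case).**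
If `V ≥ 0` and `W` are independent, `W` is exponential(`b`), and `V + W` is
exponential(`a`) with `0 < a < b`, then the law of `V` is the mixture
`(a/b)·δ_0 + (1-a/b)·exp(a)`; in particular `P(V = 0) = a/b` and
`P(V > x) = (1 - a/b) e^{-ax}` for all `x ≥ 0`. -/
theorem atom_exponential_decomposition_law
    (a b : ℝ) (ha : 0 < a) (hab : a < b)
    {Ω : Type*} [MeasurableSpace Ω] (P : Measure Ω) [IsProbabilityMeasure P]
    (V W : Ω → ℝ) (hVmeas : Measurable V) (hWmeas : Measurable W)
    (hindep : IndepFun V W P)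
    (hVpos : ∀ᵐ x ∂P, 0 ≤ V x)
    (hWlaw : Measure.map W P = expMeasure b)
    (hVWlaw : Measure.map (fun x => V x + W x) P = expMeasure a) :
    Measure.map V P
        = ENNReal.ofReal (a / b) • Measure.dirac (0 : ℝ)
          + ENNReal.ofReal (1 - a / b) • expMeasure a
      ∧ P {x | V x = 0} = ENNReal.ofReal (a / b)
      ∧ ∀ x : ℝ, 0 ≤ x →
          P {y | x < V y} = ENNReal.ofReal ((1 - a / b) * Real.exp (-a * x)) := by
  have hb : 0 < b := ha.trans hab
  have hw : 0 ≤ a / b := by positivity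
  have hw' : 0 ≤ 1 - a / b := sub_nonneg.2 ((div_le_one hb).2 hab.le)
  have := isProbabilityMeasure_expMeasure ha
  have hlaw : Measure.map V P = ENNReal.ofReal (a / b) • Measure.dirac (0 : ℝ)
      + ENNReal.ofReal (1 - a / b) • expMeasure a := by
    have := Measure.isProbabilityMeasure_map (μ := P) hVmeas.aemeasurable
    have := Measure.smul_finite (Measure.dirac (0 : ℝ)) (ENNReal.ofReal_ne_top (r := a / b))
    have := Measure.smul_finite (expMeasure a) (ENNReal.ofReal_ne_top (r := 1 - a / b))
    apply Measure.ext_of_charFun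
    ext t
    have hne : ∀ {r : ℝ}, 0 < r → (r - t * Complex.I : ℂ) ≠ 0 := fun hr h => by
      have := congrArg Complex.re h
      simp at this
      exact hr.ne' this
    have hmul := congrFun (hindep.charFun_map_fun_add_eq_mul hVmeas.aemeasurable
      hWmeas.aemeasurable) t
    rw [hVWlaw, Pi.mul_apply, hWlaw, charFun_expMeasure ha, charFun_expMeasure hb] at hmul
    have hint : ∀ (μ : Measure ℝ) [IsFiniteMeasure μ],
        Integrable (fun x : ℝ => Complex.exp (t * x * Complex.I)) μ := fun μ _ =>
      Integrable.of_bound (by fun_prop) 1 (Filter.Eventually.of_forall fun x => by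
        rw [← Complex.ofReal_mul, Complex.norm_exp_ofReal_mul_I])
    have hmix : charFun (ENNReal.ofReal (a / b) • Measure.dirac (0 : ℝ)
        + ENNReal.ofReal (1 - a / b) • expMeasure a) t
        = (a / b : ℝ) + (1 - a / b : ℝ) * (a / (a - t * Complex.I)) := by
      rw [← charFun_expMeasure ha, charFun_apply_real, charFun_apply_real,
        integral_add_measure (hint _) (hint _), integral_smul_measure, integral_smul_measure,
        ENNReal.toReal_ofReal hw, ENNReal.toReal_ofReal hw', integral_dirac]
      simp
    rw [hmix]
    have hbC : (b : ℂ) ≠ 0 := by exact_mod_cast hb.ne'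
    have h1 := hne ha
    have h2 := hne hb
    have hV : charFun (Measure.map V P) t
        = a / (a - t * Complex.I) * ((b - t * Complex.I) / b) := by
      rw [hmul]
      field_simp
    rw [hV]
    push_cast
    field_simp
    ring
  refine ⟨hlaw, ?_, fun x hx => ?_⟩
  · have h : P {x | V x = 0} = Measure.map V P {0} :=
      (Measure.map_apply hVmeas (measurableSet_singleton 0)).symm
    rw [h, hlaw]
    simp [expMeasure_singleton]
  · have h : P {y | x < V y} = Measure.map V P (Ioi x) :=
      (Measure.map_apply hVmeas measurableSet_Ioi).symm
    rw [h, hlaw, ENNReal.ofReal_mul hw', ← expMeasure_Ioi ha hx]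
    simp [hx]
end

section
/- Let 0 < a < b. Let V and W be independent real random variables on a probability space, with V ≥ 0 almost surely, W exponential(b) distributed, and V + W exponential(a) distributed. Then for every α ≥ 0, E[e^{−αV}] = (a/(a+α)) · ((b+α)/b). -/
open MeasureTheory ProbabilityTheory Set

/-- The Laplace transform of the exponential distribution. -/
lemma integral_exp_neg_mul_expMeasure {r α : ℝ} (hr : 0 < r) (hα : -r < α) :
    ∫ x, Real.exp (-α * x) ∂(expMeasure r) = r / (r + α) := by
  have hdens : expMeasure r = volume.withDensity (exponentialPDF r) := rfl
  have hmeas : Measurable (exponentialPDF r) := (measurable_exponentialPDFReal r).ennreal_ofReal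
  rw [hdens, integral_withDensity_eq_integral_toReal_smul hmeas
    (Filter.Eventually.of_forall fun _ => ENNReal.ofReal_lt_top)]
  have hint : (fun x => (exponentialPDF r x).toReal • Real.exp (-α * x)) =
      (Ici (0 : ℝ)).indicator fun x => r * Real.exp (-(r + α) * x) := by
    funext x
    by_cases hx : 0 ≤ x
    · rw [indicator_of_mem (mem_Ici.2 hx), exponentialPDF_of_nonneg hx,
        ENNReal.toReal_ofReal (by positivity), smul_eq_mul, mul_assoc, ← Real.exp_add]
      ring_nf
    · rw [indicator_of_notMem (by simpa using hx), exponentialPDF_of_neg (not_le.1 hx)]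
      simp
  rw [hint, integral_indicator measurableSet_Ici, integral_Ici_eq_integral_Ioi,
    integral_const_mul, integral_exp_mul_Ioi (by linarith)]
  simp [div_eq_mul_inv, ← inv_neg]

/-- A random variable with exponential law has the Laplace transform of that law. -/
lemma mgf_neg_of_map_eq_expMeasure {Ω : Type*} [MeasurableSpace Ω] {P : Measure Ω}
    {X : Ω → ℝ} (hX : AEMeasurable X P) {r α : ℝ} (hr : 0 < r) (hα : -r < α)
    (hlaw : Measure.map X P = expMeasure r) : mgf X P (-α) = r / (r + α) := by
  rw [← integral_exp_neg_mul_expMeasure hr hα, ← hlaw,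
    integral_map hX (by fun_prop), mgf]

/-- **Proposition 2 of the paper (formula (3.4), spectrally negative case).**
If `V ≥ 0` and `W` are independent, `W` is exponential(`b`), and `V + W` is
exponential(`a`) with `0 < a < b`, then for every `α ≥ 0`,
`E[e^{-αV}] = (a/(a+α))·((b+α)/b)`. -/
theorem lst_of_inspected_maximum_spectrally_negative
    (a b : ℝ) (ha : 0 < a) (hab : a < b)
    {Ω : Type*} [MeasurableSpace Ω] (P : Measure Ω) [IsProbabilityMeasure P]
    (V W : Ω → ℝ) (hVmeas : Measurable V) (hWmeas : Measurable W)
    (hindep : IndepFun V W P)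
    (hVpos : ∀ᵐ x ∂P, 0 ≤ V x)
    (hWlaw : Measure.map W P = expMeasure b)
    (hVWlaw : Measure.map (fun x => V x + W x) P = expMeasure a) :
    ∀ α : ℝ, 0 ≤ α →
      ∫ x, Real.exp (-α * V x) ∂P = (a / (a + α)) * ((b + α) / b) := by
  intro α hα
  have hb : 0 < b := ha.trans hab
  have hmul : mgf (V + W) P (-α) = mgf V P (-α) * mgf W P (-α) :=
    hindep.mgf_add' hVmeas.aestronglyMeasurable hWmeas.aestronglyMeasurable
  rw [mgf_neg_of_map_eq_expMeasure hWmeas.aemeasurable hb (by linarith) hWlaw,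
    mgf_neg_of_map_eq_expMeasure (hVmeas.add hWmeas).aemeasurable ha (by linarith) hVWlaw]
    at hmul
  change mgf V P (-α) = _
  have hbα : b + α ≠ 0 := by positivity
  rw [hmul]
  field_simp
end

section
/- Let ω ≠ 0, θ* and ψ_ω be real numbers with ψ_ω ≠ 0 and ψ_ω + θ* ≠ 0, and let φ : ℝ → ℝ satisfy φ(0) = 0 and φ(−θ*) = 0 and be differentiable at 0 and at −θ*. Define g(α) = (ω/(ω − φ(α))) · ((ψ_ω − α)/ψ_ω) and φ̃(α) = α − ψ_ω·(1 − g(α)) (both defined near 0 and −θ*, since ω − φ(0) = ω − φ(−θ*) = ω ≠ 0). Then: (i) φ̃(−θ*) = 0; and (ii) φ̃ is differentiable at 0 and at −θ* with φ̃'(0) = φ'(0)·ψ_ω/ω and φ̃'(−θ*) = φ'(−θ*)·(ψ_ω + θ*)/ω, so that if φ'(−θ*) ≠ 0 then −φ̃'(0)/φ̃'(−θ*) = (−φ'(0)/φ'(−θ*)) · (ψ_ω/(ψ_ω + θ*)). -/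
open Filter Topology

/-- At a zero `a` of `φ`, the function `α - ψω·(1 - (ω/(ω - φ α))·((ψω - α)/ψω))` has
derivative `φ'(a)·(ψω - a)/ω`. -/
theorem hasDerivAt_netput_exponent_of_zero {ω ψω a d : ℝ} (hω : ω ≠ 0) (hψω : ψω ≠ 0)
    {φ : ℝ → ℝ} (ha : φ a = 0) (hφ : HasDerivAt φ d a) :
    HasDerivAt (fun α => α - ψω * (1 - ω / (ω - φ α) * ((ψω - α) / ψω)))
      (d * (ψω - a) / ω) a := by
  have hne : ω - φ a ≠ 0 := by simpa [ha] using hω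
  have hquot := (hasDerivAt_const a ω).fun_div (hφ.const_sub ω) hne
  have hlin := ((hasDerivAt_id' a).const_sub ψω).div_const ψω
  refine ((hasDerivAt_id' a).fun_sub
    (((hquot.fun_mul hlin).const_sub 1).const_mul ψω)).congr_deriv ?_
  simp only [ha, sub_zero]
  field_simp
  ring

/-- **Equations (4.5)–(4.7) of the paper.**  With `φ(0) = φ(-θ*) = 0`, `ψω ≠ 0`,
`ψω + θ* ≠ 0`, set `g α = (ω/(ω - φ α))·((ψω - α)/ψω)` and `φ̃ α = α - ψω·(1 - g α)`.
Then `φ̃(-θ*) = 0`, `φ̃` is differentiable at `0` and at `-θ*` with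
`φ̃'(0) = φ'(0)·ψω/ω` and `φ̃'(-θ*) = φ'(-θ*)·(ψω + θ*)/ω`; consequently, if
`φ'(-θ*) ≠ 0` then `-φ̃'(0)/φ̃'(-θ*) = (-φ'(0)/φ'(-θ*))·(ψω/(ψω + θ*))`. -/
theorem lundberg_decay_rate_and_prefactor
    (ω θs ψω : ℝ) (hω : ω ≠ 0) (hψω : ψω ≠ 0) (hψθ : ψω + θs ≠ 0)
    (φ : ℝ → ℝ) (hφ0 : φ 0 = 0) (hφθ : φ (-θs) = 0)
    (hφd0 : DifferentiableAt ℝ φ 0) (hφdθ : DifferentiableAt ℝ φ (-θs))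
    (g φt : ℝ → ℝ)
    (hg : ∀ α, g α = (ω / (ω - φ α)) * ((ψω - α) / ψω))
    (hφt : ∀ α, φt α = α - ψω * (1 - g α)) :
    φt (-θs) = 0
      ∧ DifferentiableAt ℝ φt 0
      ∧ DifferentiableAt ℝ φt (-θs)
      ∧ deriv φt 0 = deriv φ 0 * ψω / ω
      ∧ deriv φt (-θs) = deriv φ (-θs) * (ψω + θs) / ω
      ∧ (deriv φ (-θs) ≠ 0 →
          -(deriv φt 0) / deriv φt (-θs)
            = (-(deriv φ 0) / deriv φ (-θs)) * (ψω / (ψω + θs))) := by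
  have hφt_eq : φt = fun α => α - ψω * (1 - ω / (ω - φ α) * ((ψω - α) / ψω)) := by
    funext α
    rw [hφt, hg]
  have h0 : HasDerivAt φt (deriv φ 0 * ψω / ω) 0 := by
    simpa [hφt_eq] using hasDerivAt_netput_exponent_of_zero hω hψω hφ0 hφd0.hasDerivAt
  have hθ : HasDerivAt φt (deriv φ (-θs) * (ψω + θs) / ω) (-θs) := by
    simpa [hφt_eq] using hasDerivAt_netput_exponent_of_zero hω hψω hφθ hφdθ.hasDerivAt
  refine ⟨?_, h0.differentiableAt, hθ.differentiableAt, h0.deriv, hθ.deriv, fun hd => ?_⟩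
  · rw [hφt, hg, hφθ]
    field_simp
    ring
  · rw [h0.deriv, hθ.deriv]
    field_simp
end
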